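/- arXiv:2503.21731 — 2 statements merged into one kernel-verified Lean document; each statement's English description precedes it below -/
import Mathlib

section
/- Let f be a polynomial in two variables x, y with real coefficients, regarded as a polynomial in y with coefficients in ℝ[x], of degree d in y. Let S be a connected subset of ℝ. Suppose that for every α ∈ S, the specialized univariate polynomial f_α(y) := f(α, y) ∈ ℝ[y] has degree exactly d and is squarefree (equivalently, f_α has no repeated complex root). Then the number of distinct real roots of f_α is the same for all α ∈ S. -/
open Polynomial Filter Topology

lemma Polynomial.eval_map_evalRingHom_eq_evalEval {R : Type*} [CommSemiring R] (f : R[X][X])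
    (x y : R) : (f.map (evalRingHom x)).eval y = f.evalEval x y := by
  rw [eval_map, eval₂_evalRingHom]

lemma Polynomial.contDiff_evalEval {n : WithTop ℕ∞} (f : ℝ[X][X]) :
    ContDiff ℝ n fun v : ℝ × ℝ ↦ f.evalEval v.1 v.2 := by
  simp only [← eval_map_evalRingHom_eq_evalEval, eval_map, eval₂_eq_sum_range, coe_evalRingHom]
  refine ContDiff.sum fun i _ ↦ ContDiff.mul ?_ (contDiff_snd.pow i)
  simpa [Function.comp_def] using ((f.coeff i).contDiff_aeval (𝕜 := ℝ) n).comp contDiff_fst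

/-- A simple real root `y` of `f(α, ·)` extends to a continuous local root function `ψ`, whose graph
is locally the whole zero set of `f`. -/
lemma Polynomial.exists_tendsto_eventually_evalEval_eq_zero_iff (f : ℝ[X][X]) {α y : ℝ}
    (hy : (f.map (evalRingHom α)).IsRoot y)
    (hy' : (f.map (evalRingHom α)).derivative.eval y ≠ 0) :
    ∃ ψ : ℝ → ℝ, Tendsto ψ (𝓝 α) (𝓝 y) ∧ (∀ᶠ x in 𝓝 α, f.evalEval x (ψ x) = 0) ∧
      ∀ᶠ v : ℝ × ℝ in 𝓝 (α, y), f.evalEval v.1 v.2 = 0 ↔ ψ v.1 = v.2 := by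
  have hf : HasStrictFDerivAt (fun v : ℝ × ℝ ↦ f.evalEval v.1 v.2) _ (α, y) :=
    (f.contDiff_evalEval (n := 1)).contDiffAt.hasStrictFDerivAt one_ne_zero
  set L := fderiv ℝ (fun v : ℝ × ℝ ↦ f.evalEval v.1 v.2) (α, y)
  have hL : L (0, 1) = (f.map (evalRingHom α)).derivative.eval y := by
    have h := hf.hasFDerivAt.comp_hasDerivAt y
      ((hasDerivAt_const y α).prodMk (hasDerivAt_id y))
    refine h.unique ?_
    simpa only [Function.comp_def, eval_map_evalRingHom_eq_evalEval, id]
      using (f.map (evalRingHom α)).hasDerivAt y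
  have hinv : (L ∘L .inr ℝ ℝ ℝ).IsInvertible := by
    refine ⟨ContinuousLinearEquiv.unitsEquivAut ℝ (Units.mk0 _ hy'), ?_⟩
    ext
    simp [hL]
  have h0 : f.evalEval α y = 0 := by rwa [← eval_map_evalRingHom_eq_evalEval]
  refine ⟨hf.implicitFunctionOfProdDomain hinv, hf.tendsto_implicitFunctionOfProdDomain hinv,
    ?_, ?_⟩
  · simpa only [h0] using hf.eventually_apply_implicitFunctionOfProdDomain hinv
  · simpa only [h0] using hf.eventually_apply_eq_iff_implicitFunctionOfProdDomain hinv

/-- If the degree of `f(α, ·)` is constant on `S`, its real roots are locally bounded on `S`. -/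
lemma Polynomial.exists_eventually_forall_evalEval_eq_zero_norm_le (f : ℝ[X][X]) {d : ℕ}
    {S : Set ℝ} (hdeg : ∀ α ∈ S, (f.map (evalRingHom α)).natDegree = d)
    (hne : ∀ α ∈ S, f.map (evalRingHom α) ≠ 0) {α : ℝ} (hα : α ∈ S) :
    ∃ R : ℝ, ∀ᶠ x in 𝓝[S] α, ∀ y, f.evalEval x y = 0 → ‖y‖ ≤ R := by
  let g : ℝ → NNReal := fun x ↦
    (Finset.range d).sup (fun i ↦ ‖(f.coeff i).eval x‖₊) / ‖(f.coeff d).eval x‖₊ + 1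
  have hlead : (f.coeff d).eval α ≠ 0 := by
    have := leadingCoeff_ne_zero.mpr (hne α hα)
    rwa [leadingCoeff, hdeg α hα, coeff_map, coe_evalRingHom] at this
  have hg : ContinuousAt g α := by
    refine ContinuousAt.add (ContinuousAt.div₀ ?_ ?_ (by simpa using hlead)) continuousAt_const
    · exact (Continuous.finset_sup_apply fun i _ ↦
        (f.coeff i).continuous.nnnorm).continuousAt
    · exact (f.coeff d).continuous.nnnorm.continuousAt
  refine ⟨g α + 1, ?_⟩
  have hlt : ∀ᶠ x in 𝓝[S] α, g x < g α + 1 :=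
    (hg.eventually_lt continuousAt_const (lt_add_one (g α))).filter_mono nhdsWithin_le_nhds
  filter_upwards [hlt, self_mem_nhdsWithin] with x hx hxS y hy
  have hb : cauchyBound (f.map (evalRingHom x)) = g x := by
    simp [cauchyBound, leadingCoeff, hdeg x hxS, g]
  have hroot : (f.map (evalRingHom x)).IsRoot y := by
    rwa [IsRoot, eval_map_evalRingHom_eq_evalEval]
  have := hroot.norm_lt_cauchyBound (hne x hxS)
  rw [hb] at this
  exact_mod_cast (this.trans hx).le

/-- The number of distinct real roots is locally constant on a set where the degree is constant and
all specializations are squarefree. -/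
lemma Polynomial.eventually_card_roots_map_evalRingHom_eq (f : ℝ[X][X]) {d : ℕ} {S : Set ℝ}
    (hdeg : ∀ α ∈ S, (f.map (evalRingHom α)).natDegree = d)
    (hsqf : ∀ α ∈ S, Squarefree (f.map (evalRingHom α))) {α : ℝ} (hα : α ∈ S) :
    ∀ᶠ x in 𝓝[S] α, (f.map (evalRingHom x)).roots.toFinset.card =
      (f.map (evalRingHom α)).roots.toFinset.card := by
  have hne : ∀ x ∈ S, f.map (evalRingHom x) ≠ 0 := fun x hx ↦ (hsqf x hx).ne_zero
  have hmem : ∀ x ∈ S, ∀ y, y ∈ (f.map (evalRingHom x)).roots.toFinset ↔ f.evalEval x y = 0 := by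
    intro x hx y
    rw [Multiset.mem_toFinset, mem_roots (hne x hx), IsRoot, eval_map_evalRingHom_eq_evalEval]
  set Z := (f.map (evalRingHom α)).roots.toFinset
  have hsimple : ∀ y ∈ Z, ∃ ψ : ℝ → ℝ, Tendsto ψ (𝓝 α) (𝓝 y) ∧
      (∀ᶠ x in 𝓝 α, f.evalEval x (ψ x) = 0) ∧
      ∀ᶠ v : ℝ × ℝ in 𝓝 (α, y), f.evalEval v.1 v.2 = 0 ↔ ψ v.1 = v.2 := by
    intro y hy
    have hroot : (f.map (evalRingHom α)).IsRoot y :=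
      isRoot_of_mem_roots (Multiset.mem_toFinset.mp hy)
    refine f.exists_tendsto_eventually_evalEval_eq_zero_iff hroot ?_
    have hsep : (f.map (evalRingHom α)).Separable :=
      PerfectField.separable_iff_squarefree.mpr (hsqf α hα)
    exact hsep.eval₂_derivative_ne_zero (RingHom.id ℝ) hroot
  choose! ψ hψ hψroot hψiff using hsimple
  obtain ⟨R, hR⟩ := f.exists_eventually_forall_evalEval_eq_zero_norm_le hdeg hne hα
  have hsurj : ∀ᶠ x in 𝓝 α, ∀ y ∈ Metric.closedBall (0 : ℝ) R,
      f.evalEval x y = 0 → ∃ r ∈ Z, ψ r x = y := by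
    refine (isCompact_closedBall 0 R).eventually_forall_of_forall_eventually fun y _ ↦ ?_
    by_cases hy : y ∈ Z
    · filter_upwards [hψiff y hy] with v hv h
      exact ⟨y, hy, hv.mp h⟩
    · rw [hmem α hα] at hy
      filter_upwards [(f.contDiff_evalEval (n := 0)).continuous.continuousAt.eventually_ne hy]
        with v hv h using absurd h hv
  have hinj : ∀ᶠ x in 𝓝 α, ∀ r ∈ Z, ∀ s ∈ Z, r ≠ s → ψ r x ≠ ψ s x := by
    simp only [Filter.eventually_all_finset, Filter.eventually_imp_distrib_left]
    intro r hr s hs hrs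
    filter_upwards [((hψ r hr).sub (hψ s hs)).eventually_ne (sub_ne_zero.mpr hrs)] with x hx
      using sub_ne_zero.mp hx
  have hroots : ∀ᶠ x in 𝓝 α, ∀ r ∈ Z, f.evalEval x (ψ r x) = 0 :=
    (Filter.eventually_all_finset Z).mpr hψroot
  filter_upwards [hR, self_mem_nhdsWithin, nhdsWithin_le_nhds hsurj, nhdsWithin_le_nhds hinj,
    nhdsWithin_le_nhds hroots] with x hxR hxS hxsurj hxinj hxroots
  refine (Finset.card_bij (fun r _ ↦ ψ r x) (fun r hr ↦ (hmem x hxS _).mpr (hxroots r hr))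
    (fun r hr s hs h ↦ by_contra fun hrs ↦ hxinj r hr s hs hrs h) fun y hy ↦ ?_).symm
  have hy0 := (hmem x hxS y).mp hy
  simpa using hxsurj y (by simpa using hxR y hy0) hy0

/-- Let `f` be a polynomial in two variables `x, y` with real coefficients,
regarded as a polynomial in `y` with coefficients in `ℝ[x]`, of degree `d`
in `y`. Let `S` be a connected subset of `ℝ`. Suppose that for every `α ∈ S`
the specialization `f_α(y) := f(α, y)` has degree exactly `d` and is
squarefree. Then the number of distinct real roots of `f_α` is the same for
all `α ∈ S`. -/
theorem stmt_6 (f : Polynomial (Polynomial ℝ)) (d : ℕ) (hd : f.natDegree = d)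
    (S : Set ℝ) (hS : IsConnected S)
    (hdeg : ∀ α ∈ S, (f.map (Polynomial.evalRingHom α)).natDegree = d)
    (hsqf : ∀ α ∈ S, Squarefree (f.map (Polynomial.evalRingHom α))) :
    ∀ α ∈ S, ∀ β ∈ S,
      (f.map (Polynomial.evalRingHom α)).roots.toFinset.card =
        (f.map (Polynomial.evalRingHom β)).roots.toFinset.card := by
  intro α hα β hβ
  refine hS.isPreconnected.constant
    (f := fun x ↦ (f.map (evalRingHom x)).roots.toFinset.card) (fun x hx ↦ ?_) hα hβ
  exact tendsto_const_nhds.congr'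
    ((f.eventually_card_roots_map_evalRingHom_eq hdeg hsqf hx).mono fun _ h ↦ h.symm)
end

section
/- Let f and g be polynomials in two variables x, y with real coefficients, regarded as polynomials in y with coefficients in ℝ[x], of y-degrees d and e respectively. Let S be a connected subset of ℝ. Suppose that for every α ∈ S: the specializations f_α(y) := f(α,y) and g_α(y) := g(α,y) have degrees exactly d and e, each is squarefree in ℝ[y], and f_α and g_α are coprime in ℝ[y] (equivalently, have no common complex root). Then the number of distinct real roots of the product f_α · g_α is the same for all α ∈ S. -/
open Polynomial

theorem Polynomial.exists_root_norm_sub_lt (Q : ℂ[X]) (z : ℂ) {ε : ℝ} (hε : 0 < ε)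
    (h : ‖Q.eval z‖ < ‖Q.leadingCoeff‖ * ε ^ Q.natDegree) :
    ∃ w ∈ Q.roots, ‖z - w‖ < ε := by
  by_contra! hfar
  have hs := IsAlgClosed.splits Q
  refine absurd h (not_lt.mpr ?_)
  rw [hs.eval_eq_prod_roots, norm_mul, hs.natDegree_eq_card_roots]
  refine mul_le_mul_of_nonneg_left ?_ (norm_nonneg _)
  generalize Q.roots = s at hfar
  induction s using Multiset.induction with
  | empty => simp
  | cons a s ih =>
    simp only [Multiset.map_cons, Multiset.prod_cons, norm_mul, Multiset.card_cons, pow_succ']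
    exact mul_le_mul (hfar a (Multiset.mem_cons_self a s))
      (ih fun w hw => hfar w (Multiset.mem_cons_of_mem hw)) (by positivity) (norm_nonneg _)

open Classical in
theorem Polynomial.card_roots_toFinset_eq_card_filter_im (P : ℝ[X]) (hP : P ≠ 0) :
    P.roots.toFinset.card =
      ((P.map Complex.ofRealHom).roots.toFinset.filter fun z => z.im = 0).card := by
  have hP' : P.map Complex.ofRealHom ≠ 0 := (Polynomial.map_ne_zero_iff
    Complex.ofReal_injective).mpr hP
  rw [← Finset.card_image_of_injective _ Complex.ofReal_injective]
  congr 1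
  ext z
  simp only [Finset.mem_image, Multiset.mem_toFinset, Finset.mem_filter, mem_roots hP,
    mem_roots hP', IsRoot.def]
  constructor
  · rintro ⟨x, hx, rfl⟩
    refine ⟨?_, Complex.ofReal_im x⟩
    rw [← Complex.ofRealHom_eq_coe, eval_map_apply, hx, map_zero]
  · rintro ⟨hz, him⟩
    have hzr : (z.re : ℂ) = z := Complex.ext rfl him.symm
    refine ⟨z.re, ?_, hzr⟩
    rw [← hzr, ← Complex.ofRealHom_eq_coe, eval_map_apply] at hz
    exact Complex.ofReal_injective (by simpa using hz)

open ComplexConjugate in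
theorem Polynomial.conj_mem_roots_map_ofReal (P : ℝ[X]) {z : ℂ}
    (hz : z ∈ (P.map Complex.ofRealHom).roots) :
    conj z ∈ (P.map Complex.ofRealHom).roots := by
  rw [mem_roots'] at hz ⊢
  refine ⟨hz.1, ?_⟩
  have h := hz.2
  rw [IsRoot.def, eval_map] at h ⊢
  have hcomp : (starRingEnd ℂ).comp Complex.ofRealHom = Complex.ofRealHom := by
    ext x; simp
  rw [← hcomp, ← hom_eval₂, h, map_zero]

theorem Polynomial.Separable.card_roots_toFinset_map_ofReal {P : ℝ[X]} (hP : P.Separable) :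
    (P.map Complex.ofRealHom).roots.toFinset.card = P.natDegree := by
  rw [Multiset.toFinset_card_of_nodup (nodup_roots hP.map),
    ← (IsAlgClosed.splits _).natDegree_eq_card_roots, natDegree_map]

open Classical ComplexConjugate in
theorem Polynomial.card_real_roots_eq_of_complex_roots_near {P Q : ℝ[X]} (hP : P.Separable)
    (hQ : Q.Separable) (hdeg : P.natDegree = Q.natDegree) {ε : ℝ}
    (hsep : ∀ z ∈ (P.map Complex.ofRealHom).roots, ∀ z' ∈ (P.map Complex.ofRealHom).roots,
      ‖z - z'‖ < 2 * ε → z = z')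
    (hnear : ∀ z ∈ (P.map Complex.ofRealHom).roots, ∃ w ∈ (Q.map Complex.ofRealHom).roots,
      ‖z - w‖ < ε) :
    P.roots.toFinset.card = Q.roots.toFinset.card := by
  rw [card_roots_toFinset_eq_card_filter_im P hP.ne_zero,
    card_roots_toFinset_eq_card_filter_im Q hQ.ne_zero]
  have hcard : (Q.map Complex.ofRealHom).roots.toFinset.card ≤
      (P.map Complex.ofRealHom).roots.toFinset.card := by
    rw [hP.card_roots_toFinset_map_ofReal, hQ.card_roots_toFinset_map_ofReal, hdeg]
  choose! φ hφ hφε using hnear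
  have hclose : ∀ z ∈ (P.map Complex.ofRealHom).roots, ∀ z' ∈ (P.map Complex.ofRealHom).roots,
      ∀ w, ‖z - w‖ < ε → ‖z' - w‖ < ε → z = z' := by
    intro z hz z' hz' w hw hw'
    refine hsep z hz z' hz' ?_
    calc ‖z - z'‖ = ‖(z - w) - (z' - w)‖ := by ring_nf
      _ ≤ ‖z - w‖ + ‖z' - w‖ := norm_sub_le _ _
      _ < 2 * ε := by linarith
  have hinj : ∀ z ∈ (P.map Complex.ofRealHom).roots, ∀ z' ∈ (P.map Complex.ofRealHom).roots,
      φ z = φ z' → z = z' := fun z hz z' hz' h =>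
    hclose z hz z' hz' (φ z) (hφε z hz) (h ▸ hφε z' hz')
  have hsurj : ∀ w ∈ (Q.map Complex.ofRealHom).roots,
      ∃ z ∈ (P.map Complex.ofRealHom).roots, φ z = w := by
    have h := Finset.surjOn_of_injOn_of_card_le (s := (P.map Complex.ofRealHom).roots.toFinset)
      (t := (Q.map Complex.ofRealHom).roots.toFinset) φ
      (fun z hz => Multiset.mem_toFinset.mpr (hφ z (Multiset.mem_toFinset.mp hz)))
      (fun z hz z' hz' => hinj z (Multiset.mem_toFinset.mp hz) z' (Multiset.mem_toFinset.mp hz'))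
      hcard
    intro w hw
    obtain ⟨z, hz, h⟩ := h (Multiset.mem_toFinset.mpr hw)
    exact ⟨z, Multiset.mem_toFinset.mp hz, h⟩
  have hconj : ∀ z ∈ (P.map Complex.ofRealHom).roots, φ (conj z) = conj (φ z) := by
    intro z hz
    obtain ⟨z', hz', h⟩ := hsurj _ (conj_mem_roots_map_ofReal Q (hφ z hz))
    rw [← h, hclose (conj z) (conj_mem_roots_map_ofReal P hz) z' hz' (conj (φ z)) ?_
      (h ▸ hφε z' hz')]
    rw [← map_sub, Complex.norm_conj]
    exact hφε z hz
  have him : ∀ z ∈ (P.map Complex.ofRealHom).roots, ((φ z).im = 0 ↔ z.im = 0) := by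
    intro z hz
    rw [← Complex.conj_eq_iff_im, ← Complex.conj_eq_iff_im, ← hconj z hz]
    exact ⟨hinj _ (conj_mem_roots_map_ofReal P hz) z hz, fun h => by rw [h]⟩
  refine Finset.card_bij (fun z _ => φ z) ?_ ?_ ?_
  · intro z hz
    rw [Finset.mem_filter, Multiset.mem_toFinset] at hz ⊢
    exact ⟨hφ z hz.1, (him z hz.1).mpr hz.2⟩
  · intro z hz z' hz' h
    rw [Finset.mem_filter, Multiset.mem_toFinset] at hz hz'
    exact hinj z hz.1 z' hz'.1 h
  · intro w hw
    rw [Finset.mem_filter, Multiset.mem_toFinset] at hw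
    obtain ⟨z, hz, rfl⟩ := hsurj w hw.1
    exact ⟨z, by rw [Finset.mem_filter, Multiset.mem_toFinset]; exact ⟨hz, (him z hz).mp hw.2⟩, rfl⟩

theorem Finset.exists_pos_forall_dist_lt_imp_eq {X : Type*} [MetricSpace X] (s : Finset X) :
    ∃ ε : ℝ, 0 < ε ∧ ∀ x ∈ s, ∀ y ∈ s, dist x y < ε → x = y := by
  have h : ∀ᶠ ε in nhdsWithin (0 : ℝ) (Set.Ioi 0), ∀ x ∈ s, ∀ y ∈ s, dist x y < ε → x = y := by
    simp only [Filter.eventually_all_finset]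
    intro x _ y _
    by_cases hxy : x = y
    · exact Filter.Eventually.of_forall fun _ _ => hxy
    · filter_upwards [nhdsWithin_le_nhds (Iio_mem_nhds (dist_pos.mpr hxy))] with ε hε h
      exact absurd h (not_lt.mpr (le_of_lt hε))
  obtain ⟨ε, h, hε⟩ := (h.and self_mem_nhdsWithin).exists
  exact ⟨ε, hε, h⟩

theorem Polynomial.continuous_eval_map_evalRingHom (h : ℝ[X][X]) (z : ℂ) :
    Continuous fun β : ℝ => ((h.map (evalRingHom β)).map Complex.ofRealHom).eval z := by
  simp only [map_map, eval_map, eval₂_eq_sum_range]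
  refine continuous_finsetSum _ fun i _ => Continuous.mul ?_ continuous_const
  exact Complex.continuous_ofReal.comp (h.coeff i).continuous

open Filter in
theorem Polynomial.eventually_card_real_roots_eq (h : ℝ[X][X]) {S : Set ℝ}
    (hdeg : ∀ β ∈ S, (h.map (evalRingHom β)).natDegree = h.natDegree)
    (hsep : ∀ β ∈ S, (h.map (evalRingHom β)).Separable) {α : ℝ} (hα : α ∈ S) :
    ∀ᶠ β in nhdsWithin α S, (h.map (evalRingHom α)).roots.toFinset.card =
      (h.map (evalRingHom β)).roots.toFinset.card := by
  obtain ⟨δ, hδ, hδsep⟩ := Finset.exists_pos_forall_dist_lt_imp_eq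
    ((h.map (evalRingHom α)).map Complex.ofRealHom).roots.toFinset
  have hlead : h.leadingCoeff.eval α ≠ 0 := by
    have := leadingCoeff_ne_zero.mpr (hsep α hα).ne_zero
    rwa [leadingCoeff, hdeg α hα, coeff_map] at this
  have hev : ∀ᶠ β in nhds α, ∀ z ∈ ((h.map (evalRingHom α)).map Complex.ofRealHom).roots.toFinset,
      ‖((h.map (evalRingHom β)).map Complex.ofRealHom).eval z‖ <
        ‖h.leadingCoeff.eval β‖ * (δ / 2) ^ h.natDegree := by
    rw [Filter.eventually_all_finset]
    intro z hz
    refine (continuous_eval_map_evalRingHom h z).norm.continuousAt.eventually_lt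
      (h.leadingCoeff.continuous.norm.mul continuous_const).continuousAt ?_
    rw [(mem_roots'.mp (Multiset.mem_toFinset.mp hz)).2, norm_zero]
    positivity
  filter_upwards [nhdsWithin_le_nhds hev, self_mem_nhdsWithin] with β hβ hβS
  refine card_real_roots_eq_of_complex_roots_near (ε := δ / 2) (hsep α hα) (hsep β hβS)
    ((hdeg α hα).trans (hdeg β hβS).symm) ?_ ?_
  · intro z hz z' hz' hlt
    refine hδsep z (Multiset.mem_toFinset.mpr hz) z' (Multiset.mem_toFinset.mpr hz') ?_
    rw [dist_eq_norm]
    linarith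
  · intro z hz
    refine exists_root_norm_sub_lt _ z (half_pos hδ) ?_
    have hlc : ‖((h.map (evalRingHom β)).map Complex.ofRealHom).leadingCoeff‖ =
        ‖h.leadingCoeff.eval β‖ := by
      rw [leadingCoeff_map, leadingCoeff, hdeg β hβS, coeff_map]
      exact Complex.norm_real _
    rw [hlc, natDegree_map, hdeg β hβS]
    exact hβ z (Multiset.mem_toFinset.mpr hz)

theorem Polynomial.card_real_roots_eq_of_isPreconnected (h : ℝ[X][X]) {S : Set ℝ}
    (hS : IsPreconnected S)
    (hdeg : ∀ β ∈ S, (h.map (evalRingHom β)).natDegree = h.natDegree)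
    (hsep : ∀ β ∈ S, (h.map (evalRingHom β)).Separable) {α β : ℝ} (hα : α ∈ S) (hβ : β ∈ S) :
    (h.map (evalRingHom α)).roots.toFinset.card = (h.map (evalRingHom β)).roots.toFinset.card :=
  hS.constant (f := fun x => (h.map (evalRingHom x)).roots.toFinset.card)
    (fun _ hx => tendsto_const_nhds.congr' (eventually_card_real_roots_eq h hdeg hsep hx)) hα hβ

/-- Let `f` and `g` be polynomials in two variables `x, y` with real
coefficients, regarded as polynomials in `y` with coefficients in `ℝ[x]`,
of `y`-degrees `d` and `e` respectively. Let `S` be a connected subset of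
`ℝ`. Suppose that for every `α ∈ S` the specializations `f_α` and `g_α`
have degrees exactly `d` and `e`, each is squarefree, and they are coprime
in `ℝ[y]`. Then the number of distinct real roots of the product
`f_α · g_α` is the same for all `α ∈ S`. -/
theorem stmt_7 (f g : Polynomial (Polynomial ℝ)) (d e : ℕ)
    (hd : f.natDegree = d) (he : g.natDegree = e)
    (S : Set ℝ) (hS : IsConnected S)
    (hdegf : ∀ α ∈ S, (f.map (Polynomial.evalRingHom α)).natDegree = d)
    (hdegg : ∀ α ∈ S, (g.map (Polynomial.evalRingHom α)).natDegree = e)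
    (hsqff : ∀ α ∈ S, Squarefree (f.map (Polynomial.evalRingHom α)))
    (hsqfg : ∀ α ∈ S, Squarefree (g.map (Polynomial.evalRingHom α)))
    (hcop : ∀ α ∈ S,
      IsCoprime (f.map (Polynomial.evalRingHom α)) (g.map (Polynomial.evalRingHom α))) :
    ∀ α ∈ S, ∀ β ∈ S,
      ((f.map (Polynomial.evalRingHom α)) * (g.map (Polynomial.evalRingHom α))).roots.toFinset.card =
        ((f.map (Polynomial.evalRingHom β)) * (g.map (Polynomial.evalRingHom β))).roots.toFinset.card := by
  intro α hα β hβ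
  have hsep : ∀ γ ∈ S, ((f * g).map (evalRingHom γ)).Separable := fun γ hγ => by
    rw [Polynomial.map_mul]
    exact (PerfectField.separable_iff_squarefree.mpr (hsqff γ hγ)).mul
      (PerfectField.separable_iff_squarefree.mpr (hsqfg γ hγ)) (hcop γ hγ)
  have hdeg : ∀ γ ∈ S, ((f * g).map (evalRingHom γ)).natDegree = (f * g).natDegree :=
    fun γ hγ => by
      have hf := (hsqff γ hγ).ne_zero
      have hg := (hsqfg γ hγ).ne_zero
      rw [Polynomial.map_mul, natDegree_mul hf hg, hdegf γ hγ, hdegg γ hγ,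
        natDegree_mul (fun h => hf (by rw [h, Polynomial.map_zero]))
          (fun h => hg (by rw [h, Polynomial.map_zero])), hd, he]
  rw [← Polynomial.map_mul, ← Polynomial.map_mul]
  exact card_real_roots_eq_of_isPreconnected (f * g) hS.isPreconnected hdeg hsep hα hβ
end
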